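/- Let 1 ≤ d < n be integers, ω > 0, and let Ã ∈ MAD(d+1, n−d, ω). For every ε > 0 there exists a constant C_ε > 0, depending only on ε and Ã, such that for all Q ∈ ℕ and all δ ∈ (0, 1/2]: |N(Q,δ) − (2δ)^{n−d} Q^{d+1}| ≤ ε δ^{n−d} Q^{d+1} + C_ε δ^{n−d−ω} (log(1/δ))^{d+1}, where N(Q,δ) := #{ã ∈ ℕ^{d+1} : ‖ã·Ã‖ < δ and |ã| ≤ Q}. -/

import Mathlib

/-- Distance to the nearest integer. -/
noncomputable def dNI (y : ℝ) : ℝ := |y - round y|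

/-- Supremum norm of an integer vector, as a natural number. -/
def jnorm {m : ℕ} (j : Fin m → ℤ) : ℕ := Finset.univ.sup fun i => (j i).natAbs

/-- `MAD l m ω`: the set of multiplicatively badly approximable matrices, i.e.
matrices `M ∈ ℝ^{l×m}` with `inf_{j ∈ ℤ^m \ {0}} |j|^ω ∏_u ‖j·row_u(M)‖ > 0`. -/
def MAD (l m : ℕ) (ω : ℝ) (M : Matrix (Fin l) (Fin m) ℝ) : Prop :=
  ∃ c : ℝ, 0 < c ∧ ∀ j : Fin m → ℤ, j ≠ 0 →
    c ≤ (jnorm j : ℝ) ^ ω * ∏ u, dNI (∑ v, (j v : ℝ) * M u v)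

lemma dNI_nonneg (y : ℝ) : 0 ≤ dNI y := abs_nonneg _

lemma dNI_le_half (y : ℝ) : dNI y ≤ 1 / 2 := abs_sub_round y

lemma dNI_le_abs_sub (y : ℝ) (k : ℤ) : dNI y ≤ |y - k| := round_le y k

/-- The linear form `j · row_u(M)`. -/
noncomputable def rowForm {l m : ℕ} (M : Matrix (Fin l) (Fin m) ℝ) (j : Fin m → ℤ)
    (u : Fin l) : ℝ := ∑ v, (j v : ℝ) * M u v

lemma rowForm_sub {l m : ℕ} (M : Matrix (Fin l) (Fin m) ℝ) (j k : Fin m → ℤ) (u : Fin l) :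
    rowForm M (j - k) u = rowForm M j u - rowForm M k u := by
  simp [rowForm, sub_mul, Finset.sum_sub_distrib]

lemma jnorm_sub_le {m : ℕ} (j k : Fin m → ℤ) : jnorm (j - k) ≤ jnorm j + jnorm k := by
  refine Finset.sup_le fun i _ => ?_
  have h1 : (j i).natAbs ≤ jnorm j :=
    Finset.le_sup (f := fun i => (j i).natAbs) (Finset.mem_univ i)
  have h2 : (k i).natAbs ≤ jnorm k :=
    Finset.le_sup (f := fun i => (k i).natAbs) (Finset.mem_univ i)
  simp only [Pi.sub_apply]
  omega

lemma jnorm_pos {m : ℕ} {j : Fin m → ℤ} (hj : j ≠ 0) : 1 ≤ jnorm j := by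
  obtain ⟨i, hi⟩ := Function.ne_iff.mp hj
  have h1 : (j i).natAbs ≤ jnorm j :=
    Finset.le_sup (f := fun i => (j i).natAbs) (Finset.mem_univ i)
  simp only [Pi.zero_apply] at hi
  omega

lemma card_le_of_separated {α : Type*} (G : Finset α) (f : α → ℝ) {R η : ℝ} (hη : 0 < η)
    (hf : ∀ x ∈ G, |f x| ≤ R) (hR : 0 ≤ R)
    (hsep : ∀ x ∈ G, ∀ y ∈ G, x ≠ y → η ≤ |f x - f y|) :
    (G.card : ℝ) ≤ 2 * R / η + 2 := by
  have hcard : G.card ≤ (Finset.Icc ⌊-R / η⌋ ⌊R / η⌋).card := by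
    refine Finset.card_le_card_of_injOn (fun x => ⌊f x / η⌋) ?_ ?_
    · intro x hx
      have := abs_le.mp (hf x hx)
      simp only [Finset.coe_Icc, Set.mem_Icc]
      exact ⟨Int.floor_mono (by gcongr; exact this.1), Int.floor_mono (by gcongr; exact this.2)⟩
    · intro x hx y hy hxy
      by_contra hne
      have h1 := Int.abs_sub_lt_one_of_floor_eq_floor hxy
      have h2 := hsep x hx y hy hne
      rw [← sub_div, abs_div, abs_of_pos hη, div_lt_one hη] at h1
      linarith
  have hle : ⌊-R / η⌋ ≤ ⌊R / η⌋ := Int.floor_mono (by gcongr; linarith)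
  have h1 : (G.card : ℝ) ≤ (⌊R / η⌋ + 1 - ⌊-R / η⌋ : ℤ) := by
    rw [Int.card_Icc] at hcard
    have : (G.card : ℤ) ≤ ⌊R / η⌋ + 1 - ⌊-R / η⌋ := by omega
    exact_mod_cast this
  have h2 := Int.floor_le (R / η)
  have h3 := Int.lt_floor_add_one (-R / η)
  push_cast at h1
  rw [neg_div] at h3
  have : 2 * R / η = R / η + R / η := by ring
  rw [neg_div] at h1
  linarith

lemma sum_prod_inv_box_le {d m : ℕ} {ω : ℝ} (hω : 0 < ω)
    (M : Matrix (Fin (d + 1)) (Fin m) ℝ) {c : ℝ} (hc : 0 < c)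
    (hM : ∀ j : Fin m → ℤ, j ≠ 0 → c ≤ (jnorm j : ℝ) ^ ω * ∏ u, dNI (rowForm M j u))
    {J : ℝ} (hJ : 1 ≤ J) (G : Finset (Fin m → ℤ))
    (hG : ∀ j ∈ G, j ≠ 0 ∧ (jnorm j : ℝ) ≤ J)
    (b : Fin (d + 1) → ℝ) (hb : ∀ u, 0 < b u)
    (hGb : ∀ j ∈ G, ∀ u, b u ≤ dNI (rowForm M j u) ∧ dNI (rowForm M j u) ≤ 2 * b u) :
    ∑ j ∈ G, ∏ u, (dNI (rowForm M j u))⁻¹ ≤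
      (4 * 4 ^ d * 2 ^ ω + 2 * 2 ^ (d + 1)) / c * J ^ ω := by
  have hJ0 : 0 < J := by linarith
  rcases G.eq_empty_or_nonempty with rfl | ⟨j₀, hj₀⟩
  · simp only [Finset.sum_empty]; positivity
  have hV : 0 < ∏ u, b u := Finset.prod_pos fun u _ => hb u
  set V := ∏ u, b u with hVdef
  have hV1 : 1 ≤ 2 ^ (d + 1) * V * J ^ ω / c := by
    rw [le_div_iff₀ hc, one_mul]
    calc c ≤ _ := hM j₀ (hG j₀ hj₀).1
      _ ≤ J ^ ω * ∏ u, (2 * b u) := by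
        gcongr with u
        · exact Finset.prod_nonneg fun u _ => dNI_nonneg _
        · exact (hG j₀ hj₀).2
        · exact fun _ _ => dNI_nonneg _
        · exact (hGb j₀ hj₀ u).2
      _ = _ := by
        rw [Finset.prod_mul_distrib]; simp; ring
  have hsum : ∑ j ∈ G, ∏ u, (dNI (rowForm M j u))⁻¹ ≤ G.card * V⁻¹ := by
    rw [← nsmul_eq_mul]
    refine Finset.sum_le_card_nsmul _ _ _ fun j hj => ?_
    rw [hVdef, ← Finset.prod_inv_distrib]
    refine Finset.prod_le_prod (fun u _ => inv_nonneg.mpr (dNI_nonneg _)) fun u _ => ?_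
    exact inv_anti₀ (hb u) (hGb j hj u).1
  have hJ2 : 0 < (2 * J) ^ ω := by positivity
  set W := ∏ u : Fin d, b u.succ with hWdef
  have hW : 0 < W := Finset.prod_pos fun u _ => hb _
  have hVW : V = b 0 * W := Fin.prod_univ_succ _
  set η := c / ((2 * J) ^ ω * (4 ^ d * W)) with hη
  have hη0 : 0 < η := by positivity
  have hcard := card_le_of_separated G
    (fun j => rowForm M j 0 - round (rowForm M j 0)) (R := 2 * b 0) (η := η) hη0
    (fun j hj => (hGb j hj 0).2) (by linarith [hb 0]) (by
      intro j hj k hk hjk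
      have hne : j - k ≠ 0 := sub_ne_zero.mpr hjk
      have hn : (jnorm (j - k) : ℝ) ≤ 2 * J := by
        have h1 : (jnorm (j - k) : ℝ) ≤ jnorm j + jnorm k := by exact_mod_cast jnorm_sub_le j k
        linarith [(hG j hj).2, (hG k hk).2]
      have hd : ∀ u, dNI (rowForm M (j - k) u) ≤
          |(rowForm M j u - round (rowForm M j u)) - (rowForm M k u - round (rowForm M k u))| := by
        intro u
        refine (dNI_le_abs_sub _ (round (rowForm M j u) - round (rowForm M k u))).trans_eq ?_
        rw [rowForm_sub]; push_cast; congr 1; ring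
      have hd' : ∀ u : Fin d, dNI (rowForm M (j - k) u.succ) ≤ 4 * b u.succ := by
        intro u
        refine (hd u.succ).trans ((abs_sub _ _).trans ?_)
        have h1 := (hGb j hj u.succ).2
        have h2 := (hGb k hk u.succ).2
        simp only [dNI] at h1 h2
        linarith
      rw [hη, div_le_iff₀ (by positivity)]
      calc c ≤ _ := hM _ hne
        _ ≤ (2 * J) ^ ω * (|(rowForm M j 0 - round (rowForm M j 0)) -
              (rowForm M k 0 - round (rowForm M k 0))| * ∏ u : Fin d, (4 * b u.succ)) := by
          rw [Fin.prod_univ_succ]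
          gcongr with u
          · exact mul_nonneg (dNI_nonneg _) (Finset.prod_nonneg fun u _ => dNI_nonneg _)
          · exact Finset.prod_nonneg fun u _ => dNI_nonneg _
          · exact hd 0
          · exact fun _ _ => dNI_nonneg _
          · exact hd' u
        _ = _ := by
          rw [Finset.prod_mul_distrib]; simp; ring)
  calc _ ≤ G.card * V⁻¹ := hsum
    _ ≤ (2 * (2 * b 0) / η + 2 * (2 ^ (d + 1) * V * J ^ ω / c)) * V⁻¹ := by
      gcongr; linarith
    _ = _ := by
      rw [hη, hVW, Real.mul_rpow (by norm_num) hJ0.le]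
      have := (hb 0).ne'
      field_simp
      ring

lemma exists_sum_prod_inv_le {d m : ℕ} {ω : ℝ} (hω : 0 < ω)
    (M : Matrix (Fin (d + 1)) (Fin m) ℝ) (hM : MAD (d + 1) m ω M) :
    ∃ C : ℝ, 0 < C ∧ ∀ J : ℝ, 1 ≤ J → ∀ F : Finset (Fin m → ℤ),
      (∀ j ∈ F, j ≠ 0 ∧ (jnorm j : ℝ) ≤ J) →
      ∑ j ∈ F, ∏ u, (dNI (rowForm M j u))⁻¹ ≤ C * J ^ ω * (1 + Real.log J) ^ (d + 1) := by
  obtain ⟨c, hc, hM⟩ := hM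
  change ∀ j : Fin m → ℤ, j ≠ 0 → c ≤ (jnorm j : ℝ) ^ ω * ∏ u, dNI (rowForm M j u) at hM
  have hl2 : 0 < Real.log 2 := Real.log_pos one_lt_two
  set B := 2 + (ω + |Real.log c|) / Real.log 2 with hB
  have hB0 : 0 < B := by positivity
  set K := (4 * 4 ^ d * 2 ^ ω + 2 * 2 ^ (d + 1)) / c with hK
  have hK0 : 0 < K := by positivity
  refine ⟨B ^ (d + 1) * K, by positivity, fun J hJ F hF => ?_⟩
  have hJ0 : 0 < J := by linarith
  have hlJ : 0 ≤ Real.log J := Real.log_nonneg hJ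
  rcases F.eq_empty_or_nonempty with rfl | ⟨j₀, hj₀⟩
  · simp only [Finset.sum_empty]; positivity
  set p := c / J ^ ω with hp
  have hp0 : 0 < p := by positivity
  have hpd : ∀ j ∈ F, ∀ u, p ≤ dNI (rowForm M j u) := by
    intro j hj u
    rw [hp, div_le_iff₀ (by positivity), mul_comm]
    calc c ≤ _ := hM j (hF j hj).1
      _ ≤ J ^ ω * dNI (rowForm M j u) := by
        gcongr
        · exact Finset.prod_nonneg fun u _ => dNI_nonneg _
        · exact (hF j hj).2
        · rw [← Finset.mul_prod_erase _ _ (Finset.mem_univ u)]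
          refine mul_le_of_le_one_right (dNI_nonneg _) ?_
          exact Finset.prod_le_one (fun _ _ => dNI_nonneg _)
            fun _ _ => (dNI_le_half _).trans (by norm_num)
  set S := Finset.Icc (Int.log 2 p) 0 with hS
  have hp1 : p ≤ 1 := (hpd j₀ hj₀ 0).trans ((dNI_le_half _).trans (by norm_num))
  have hlog0 : Int.log 2 p ≤ 0 := by
    have := Int.log_mono_right (b := 2) hp0 hp1
    simpa using this
  have hScard : (S.card : ℝ) ≤ B * (1 + Real.log J) := by
    have h1 : (S.card : ℤ) = 1 - Int.log 2 p := by
      rw [hS, Int.card_Icc]; omega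
    have h2 : (S.card : ℝ) = 1 - Int.log 2 p := by exact_mod_cast h1
    have h3 : p < (2 : ℝ) ^ (Int.log 2 p + 1) := by
      exact_mod_cast Int.lt_zpow_succ_log_self (b := 2) one_lt_two p
    have h4 := Real.log_lt_log hp0 h3
    rw [Real.log_zpow, hp, Real.log_div hc.ne' (by positivity), Real.log_rpow hJ0] at h4
    push_cast at h4
    have h5 : -(Int.log 2 p : ℝ) ≤ 1 + (ω * Real.log J + |Real.log c|) / Real.log 2 := by
      rw [← sub_le_iff_le_add', le_div_iff₀ hl2]
      have := le_abs_self (Real.log c)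
      have := neg_abs_le (Real.log c)
      rw [← hp] at h4
      linarith
    have h6 : B * (1 + Real.log J) = 2 + (ω * Real.log J + |Real.log c|) / Real.log 2 +
        (2 * Real.log J + ω / Real.log 2 + |Real.log c| * Real.log J / Real.log 2) := by
      rw [hB]; field_simp; ring
    rw [h2, h6]
    have : 0 ≤ 2 * Real.log J + ω / Real.log 2 + |Real.log c| * Real.log J / Real.log 2 := by
      positivity
    linarith
  set z : (Fin m → ℤ) → Fin (d + 1) → ℤ := fun j u => Int.log 2 (dNI (rowForm M j u)) with hz
  have hmaps : ∀ j ∈ F, z j ∈ Fintype.piFinset fun _ : Fin (d + 1) => S := by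
    intro j hj
    rw [Fintype.mem_piFinset]
    intro u
    have h1 := hpd j hj u
    rw [hS, Finset.mem_Icc]
    refine ⟨Int.log_mono_right hp0 h1, ?_⟩
    have := Int.log_mono_right (b := 2) (hp0.trans_le h1)
      ((dNI_le_half (rowForm M j u)).trans (by norm_num : (1 / 2 : ℝ) ≤ 1))
    simpa using this
  rw [← Finset.sum_fiberwise_of_maps_to hmaps]
  calc _ ≤ ((Fintype.piFinset fun _ : Fin (d + 1) => S).card) • (K * J ^ ω) := by
        refine Finset.sum_le_card_nsmul _ _ _ fun y _ => ?_
        refine sum_prod_inv_box_le hω M hc hM hJ _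
          (fun j hj => hF j (Finset.mem_filter.mp hj).1) (fun u => (2 : ℝ) ^ (y u))
          (fun u => by positivity) fun j hj u => ?_
        obtain ⟨hjF, rfl⟩ := Finset.mem_filter.mp hj
        have h0 : 0 < dNI (rowForm M j u) := hp0.trans_le (hpd j hjF u)
        have h1 := Int.zpow_log_le_self (b := 2) one_lt_two h0
        have h2 := Int.lt_zpow_succ_log_self (b := 2) one_lt_two (dNI (rowForm M j u))
        rw [zpow_add_one₀ (by norm_num), mul_comm] at h2
        exact ⟨by exact_mod_cast h1, by exact_mod_cast h2.le⟩
    _ = (S.card : ℝ) ^ (d + 1) * (K * J ^ ω) := by simp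
    _ ≤ (B * (1 + Real.log J)) ^ (d + 1) * (K * J ^ ω) := by gcongr
    _ = _ := by rw [mul_pow]; ring

lemma exists_weighted_sum_le {d m : ℕ} {ω : ℝ} (hω : 0 < ω)
    (M : Matrix (Fin (d + 1)) (Fin m) ℝ) (hM : MAD (d + 1) m ω M) {B : ℝ} (hB : 1 ≤ B) :
    ∃ C : ℝ, 0 < C ∧ ∀ δ : ℝ, 0 < δ → δ ≤ 1 / 2 → ∀ W : ℝ → ℝ, (∀ x, 0 ≤ W x) →
      (∀ x, (1 + |x|) ^ (⌈ω⌉₊ + d + 3) * W x ≤ B) → ∀ F : Finset (Fin m → ℤ),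
      (∀ j ∈ F, j ≠ 0) →
      ∑ j ∈ F, (∏ v, W (δ * j v)) * ∏ u, (dNI (rowForm M j u))⁻¹ ≤
        C * δ ^ (-ω) * Real.log (1 / δ) ^ (d + 1) := by
  obtain ⟨C, hC, hS⟩ := exists_sum_prod_inv_le hω M hM
  set k := ⌈ω⌉₊ + d + 3 with hk
  have hsm : Summable fun i : ℕ => ((i : ℝ) ^ 2)⁻¹ := by
    simp
  set T := ∑' i : ℕ, ((i : ℝ) ^ 2)⁻¹ with hT
  have hT0 : 0 ≤ T := tsum_nonneg fun i => by positivity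
  refine ⟨B ^ m * C * 3 ^ (d + 1) * (T + 1), by positivity, fun δ hδ hδ2 W hW hWB F hF => ?_⟩
  set L := Real.log (1 / δ) with hL
  have hL2 : 1 / 2 ≤ L := by
    have h1 : Real.log 2 ≤ L := Real.log_le_log two_pos (by rw [le_div_iff₀ hδ]; linarith)
    linarith [Real.log_two_gt_d9]
  have hW1 : ∀ x, W x ≤ B := fun x => by
    refine le_trans (le_mul_of_one_le_left (hW x) ?_) (hWB x)
    exact one_le_pow₀ (by linarith [abs_nonneg x])
  set i : (Fin m → ℤ) → ℕ := fun j => ⌈δ * jnorm j⌉₊ with hi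
  have hipos : ∀ j ∈ F, 1 ≤ i j := fun j hj => by
    have h1 := jnorm_pos (hF j hj)
    exact Nat.one_le_iff_ne_zero.mpr (Nat.ceil_pos.mpr (by positivity)).ne'
  have hweight : ∀ j ∈ F, ∏ v, W (δ * j v) ≤ B ^ m * ((i j : ℝ) ^ k)⁻¹ := by
    intro j hj
    have hne : (Finset.univ : Finset (Fin m)).Nonempty := by
      obtain ⟨v, -⟩ := Function.ne_iff.mp (hF j hj)
      exact ⟨v, Finset.mem_univ v⟩
    obtain ⟨v, -, hv⟩ := Finset.exists_mem_eq_sup _ hne fun v => (j v).natAbs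
    have hv : jnorm j = (j v).natAbs := hv
    have hij : (i j : ℝ) ≤ 1 + |δ * j v| := by
      have h1 := (Nat.ceil_lt_add_one (by positivity : 0 ≤ δ * (jnorm j : ℝ))).le
      have h2 : δ * (jnorm j : ℝ) = |δ * j v| := by
        rw [hv, Nat.cast_natAbs, abs_mul, abs_of_pos hδ]; simp
      rw [← h2]; linarith
    have hi0 : (0 : ℝ) < i j := by exact_mod_cast hipos j hj
    rw [← Finset.mul_prod_erase _ _ (Finset.mem_univ v)]
    have hm : m = (Finset.univ.erase v).card + 1 := by
      rw [Finset.card_erase_of_mem (Finset.mem_univ v), Finset.card_univ, Fintype.card_fin]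
      have := v.pos
      omega
    calc _ ≤ (B * ((i j : ℝ) ^ k)⁻¹) * ∏ _w ∈ Finset.univ.erase v, B := by
          gcongr with w
          · exact Finset.prod_nonneg fun _ _ => hW _
          · rw [← div_eq_mul_inv, le_div_iff₀ (by positivity), mul_comm]
            refine le_trans ?_ (hWB (δ * j v))
            gcongr
            exact hW _
          · exact fun _ _ => hW _
          · exact hW1 _
      _ = _ := by
        conv_rhs => rw [hm]
        rw [Finset.prod_const, pow_succ]; ring
  have hmaps : ∀ j ∈ F, i j ∈ F.image i := fun j hj => Finset.mem_image_of_mem _ hj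
  rw [← Finset.sum_fiberwise_of_maps_to hmaps]
  have hfiber : ∀ y ∈ F.image i, ∑ j ∈ F with i j = y,
      (∏ v, W (δ * j v)) * ∏ u, (dNI (rowForm M j u))⁻¹ ≤
        B ^ m * C * 3 ^ (d + 1) * δ ^ (-ω) * L ^ (d + 1) * ((y : ℝ) ^ 2)⁻¹ := by
    intro y hy
    obtain ⟨j₀, hj₀, rfl⟩ := Finset.mem_image.mp hy
    set y := i j₀
    have hy1 : 1 ≤ (y : ℝ) := by exact_mod_cast hipos j₀ hj₀
    have hy0 : 0 < (y : ℝ) := by linarith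
    have hJ : 1 ≤ (y : ℝ) / δ := by rw [le_div_iff₀ hδ]; linarith
    have hlog : 1 + Real.log (y / δ) ≤ 3 * y * L := by
      have h1 : Real.log (y / δ) = Real.log y + L := by
        rw [hL, div_eq_mul_one_div, Real.log_mul hy0.ne' (by positivity)]
      have h2 := Real.log_le_sub_one_of_pos hy0
      nlinarith
    have hlog0 : 0 ≤ Real.log (y / δ) := Real.log_nonneg hJ
    calc _ ≤ ∑ j ∈ F with i j = y, B ^ m * ((y : ℝ) ^ k)⁻¹ *
            ∏ u, (dNI (rowForm M j u))⁻¹ := by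
          refine Finset.sum_le_sum fun j hj => ?_
          obtain ⟨hj, hjy⟩ := Finset.mem_filter.mp hj
          have := hweight j hj
          rw [hjy] at this
          gcongr
          exact Finset.prod_nonneg fun _ _ => inv_nonneg.mpr (dNI_nonneg _)
      _ = B ^ m * ((y : ℝ) ^ k)⁻¹ *
            ∑ j ∈ F with i j = y, ∏ u, (dNI (rowForm M j u))⁻¹ := by rw [Finset.mul_sum]
      _ ≤ B ^ m * ((y : ℝ) ^ k)⁻¹ *
            (C * ((y : ℝ) / δ) ^ ω * (1 + Real.log (y / δ)) ^ (d + 1)) := by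
          gcongr
          refine hS _ hJ _ fun j hj => ?_
          obtain ⟨hj, hjy⟩ := Finset.mem_filter.mp hj
          refine ⟨hF j hj, ?_⟩
          rw [le_div_iff₀ hδ, mul_comm, ← hjy]
          exact Nat.le_ceil _
      _ ≤ B ^ m * ((y : ℝ) ^ k)⁻¹ *
            (C * ((y : ℝ) ^ ⌈ω⌉₊ * δ ^ (-ω)) * (3 * y * L) ^ (d + 1)) := by
          gcongr
          rw [Real.div_rpow hy0.le hδ.le, Real.rpow_neg hδ.le, div_eq_mul_inv]
          gcongr
          rw [← Real.rpow_natCast]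
          exact Real.rpow_le_rpow_of_exponent_le hy1 (Nat.le_ceil _)
      _ = _ := by
        rw [hk]
        field_simp
        ring
  refine (Finset.sum_le_sum hfiber).trans ?_
  rw [← Finset.mul_sum]
  have h1 := hsm.sum_le_tsum (F.image i) fun _ _ => by positivity
  calc _ ≤ B ^ m * C * 3 ^ (d + 1) * δ ^ (-ω) * L ^ (d + 1) * (T + 1) := by
        gcongr
        linarith
    _ = _ := by ring

/-- The additive character `θ ↦ exp (2πiθ)`. -/
noncomputable def expTwoPi (θ : ℝ) : ℂ := Complex.exp (2 * Real.pi * Complex.I * θ)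

lemma expTwoPi_sum {ι : Type*} (s : Finset ι) (f : ι → ℝ) :
    expTwoPi (∑ i ∈ s, f i) = ∏ i ∈ s, expTwoPi (f i) := by
  simp only [expTwoPi]
  rw [← Complex.exp_sum, Complex.ofReal_sum, Finset.mul_sum]

lemma expTwoPi_nat_mul (a : ℕ) (θ : ℝ) : expTwoPi (a * θ) = expTwoPi θ ^ a := by
  simp only [expTwoPi]
  rw [← Complex.exp_nat_mul]
  push_cast
  ring_nf

lemma norm_expTwoPi (θ : ℝ) : ‖expTwoPi θ‖ = 1 := by
  have : 2 * (Real.pi : ℂ) * Complex.I * θ = ((2 * Real.pi * θ : ℝ) : ℂ) * Complex.I := by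
    push_cast; ring
  rw [expTwoPi, this, Complex.norm_exp_ofReal_mul_I]

lemma four_mul_dNI_le (θ : ℝ) : 4 * dNI θ ≤ ‖expTwoPi θ - 1‖ := by
  set t := θ - round θ with ht
  have h1 : expTwoPi θ = Complex.exp (Complex.I * ((2 * Real.pi * t : ℝ) : ℂ)) := by
    rw [expTwoPi, Complex.exp_eq_exp_iff_exists_int]
    exact ⟨round θ, by rw [ht]; push_cast; ring⟩
  have ha : |t| ≤ 1 / 2 := abs_sub_round θ
  have hpi := Real.pi_pos
  rw [h1, Complex.norm_exp_I_mul_ofReal_sub_one, norm_mul, Real.norm_eq_abs, Real.norm_eq_abs,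
    abs_two, Real.abs_sin_eq_sin_abs_of_abs_le_pi]
  · have h2 : |2 * Real.pi * t / 2| = Real.pi * |t| := by
      rw [show 2 * Real.pi * t / 2 = Real.pi * t by ring, abs_mul, abs_of_pos hpi]
    rw [h2]
    have h3 := Real.mul_le_sin (x := Real.pi * |t|) (by positivity) (by nlinarith)
    have h4 : 2 / Real.pi * (Real.pi * |t|) = 2 * |t| := by field_simp
    rw [h4] at h3
    have : dNI θ = |t| := rfl
    linarith
  · rw [show 2 * Real.pi * t / 2 = Real.pi * t by ring, abs_mul, abs_of_pos hpi]
    nlinarith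

lemma norm_sum_expTwoPi_le (Q : ℕ) {θ : ℝ} (hθ : 0 < dNI θ) :
    ‖∑ a ∈ Finset.Icc 1 Q, expTwoPi (a * θ)‖ ≤ (dNI θ)⁻¹ := by
  have h4 := four_mul_dNI_le θ
  have hne : expTwoPi θ ≠ 1 := by
    intro h
    rw [h, sub_self, norm_zero] at h4
    linarith
  have h1 : ∑ a ∈ Finset.Icc 1 Q, expTwoPi (a * θ) =
      expTwoPi θ * ((expTwoPi θ ^ Q - 1) / (expTwoPi θ - 1)) := by
    rw [← geom_sum_eq hne, Finset.mul_sum]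
    refine Finset.sum_bij (fun a _ => a - 1) ?_ ?_ ?_ ?_
    · intro a ha
      simp only [Finset.mem_Icc, Finset.mem_range] at *
      omega
    · intro a ha b hb
      simp only [Finset.mem_Icc] at *
      omega
    · intro b hb
      exact ⟨b + 1, by simp only [Finset.mem_Icc, Finset.mem_range] at *; omega, by simp⟩
    · intro a ha
      rw [expTwoPi_nat_mul, ← pow_succ', Nat.sub_add_cancel (Finset.mem_Icc.mp ha).1]
  rw [h1, norm_mul, norm_expTwoPi, one_mul, norm_div]
  have h2 : ‖expTwoPi θ ^ Q - 1‖ ≤ 2 := by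
    refine (norm_sub_le _ _).trans ?_
    rw [norm_pow, norm_expTwoPi, one_pow, norm_one]
    norm_num
  calc _ ≤ 2 / (4 * dNI θ) := by gcongr
    _ ≤ _ := by
      rw [div_le_iff₀ (by positivity), ← mul_assoc, mul_comm _ (4 : ℝ), mul_assoc,
        inv_mul_cancel₀ hθ.ne']
      norm_num

lemma hasSum_periodization (φ : SchwartzMap ℝ ℂ) {δ : ℝ} (hδ : 0 < δ) (x : ℝ) :
    HasSum (fun n : ℤ => (δ : ℂ) * FourierTransform.fourier (φ : ℝ → ℂ) (δ * n) *
      expTwoPi (n * x)) (∑' n : ℤ, φ ((x + n) / δ)) := by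
  set e : ℝ ≃L[ℝ] ℝ := ContinuousLinearEquiv.unitsEquivAut ℝ (Units.mk0 δ⁻¹ (by positivity)) with he
  set ψ : SchwartzMap ℝ ℂ := SchwartzMap.compCLMOfContinuousLinearEquiv ℝ e φ with hψ
  have hψx : ∀ y, ψ y = φ (y / δ) := by
    intro y
    simp [hψ, he, div_eq_mul_inv]
  have hF : ∀ w : ℝ, FourierTransform.fourier ψ w =
      (δ : ℂ) * FourierTransform.fourier (φ : ℝ → ℂ) (δ * w) := by
    intro w
    rw [SchwartzMap.fourier_coe, Real.fourier_real_eq_integral_exp_smul,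
      Real.fourier_real_eq_integral_exp_smul]
    have := MeasureTheory.Measure.integral_comp_div
      (fun v : ℝ => Complex.exp (↑(-2 * Real.pi * v * (δ * w)) * Complex.I) • φ v) δ
    rw [abs_of_pos hδ, Complex.real_smul] at this
    rw [← this]
    congr 1
    ext v
    rw [hψx]
    congr 4
    field_simp
  have hsum : Summable fun n : ℤ => FourierTransform.fourier ψ (n : ℝ) :=
    summable_of_isBigO (Real.summable_abs_int_rpow one_lt_two)
      (((FourierTransform.fourier ψ).isBigO_cocompact_rpow (-2)).comp_tendsto
        Int.tendsto_coe_cofinite)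
  have hch : ∀ n : ℤ, fourier n (x : UnitAddCircle) = expTwoPi (n * x) := by
    intro n
    rw [fourier_coe_apply, expTwoPi]
    congr 1
    push_cast
    ring
  have hP := SchwartzMap.tsum_eq_tsum_fourier ψ x
  have hsum' : Summable fun n : ℤ => FourierTransform.fourier ψ (n : ℝ) *
      fourier n (x : UnitAddCircle) := by
    refine Summable.of_norm ?_
    simpa [hch, norm_expTwoPi] using hsum.norm
  have h := hsum'.hasSum
  rw [← hP] at h
  simpa only [hF, hch, hψx] using h

lemma exists_smooth_count {d m : ℕ} {ω : ℝ} (hω : 0 < ω)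
    (M : Matrix (Fin (d + 1)) (Fin m) ℝ) (hM : MAD (d + 1) m ω M) (φ : SchwartzMap ℝ ℂ) :
    ∃ C : ℝ, 0 < C ∧ ∀ Q : ℕ, ∀ δ : ℝ, 0 < δ → δ ≤ 1 / 2 →
      ‖∑ a ∈ Fintype.piFinset fun _ : Fin (d + 1) => Finset.Icc 1 Q,
          ∏ v, ∑' n : ℤ, φ (((∑ u, (a u : ℝ) * M u v) + n) / δ) -
        (δ * ∫ x, φ x) ^ m * Q ^ (d + 1)‖ ≤
      C * (δ ^ m * δ ^ (-ω)) * Real.log (1 / δ) ^ (d + 1) := by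
  set k := ⌈ω⌉₊ + d + 3 with hk
  set Φ : SchwartzMap ℝ ℂ := FourierTransform.fourier φ with hΦ
  have hdec : ∃ B : ℝ, 1 ≤ B ∧ ∀ x, (1 + |x|) ^ k * ‖Φ x‖ ≤ B := by
    have h : ∀ x, (1 + |x|) ^ k * ‖Φ x‖ ≤ 2 ^ k *
        (Finset.Iic (k, 0)).sup (fun q : ℕ × ℕ => SchwartzMap.seminorm ℝ q.1 q.2) Φ := fun x => by
      simpa using
        SchwartzMap.one_add_le_sup_seminorm_apply (𝕜 := ℝ) (m := (k, 0)) le_rfl le_rfl Φ x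
    exact ⟨max 1 _, le_max_left _ _, fun x => (h x).trans (le_max_right _ _)⟩
  obtain ⟨B, hB, hBΦ⟩ := hdec
  obtain ⟨C, hC, hCb⟩ := exists_weighted_sum_le hω M hM hB
  refine ⟨C, hC, fun Q δ hδ hδ2 => ?_⟩
  have hpos : ∀ j : Fin m → ℤ, j ≠ 0 → ∀ u, 0 < dNI (rowForm M j u) := by
    obtain ⟨c, hc, hM⟩ := hM
    intro j hj u
    refine lt_of_le_of_ne (dNI_nonneg _) fun h => ?_
    have h1 := hM j hj
    change c ≤ (jnorm j : ℝ) ^ ω * ∏ u, dNI (rowForm M j u) at h1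
    rw [Finset.prod_eq_zero (Finset.mem_univ u) h.symm, mul_zero] at h1
    linarith
  have hlim : Filter.Tendsto (fun s : Finset ℤ =>
      ∑ a ∈ Fintype.piFinset fun _ : Fin (d + 1) => Finset.Icc 1 Q,
        ∏ v, ∑ n ∈ s, ((δ : ℂ) * Φ (δ * n) * expTwoPi (n * ∑ u, (a u : ℝ) * M u v)))
      Filter.atTop (nhds (∑ a ∈ Fintype.piFinset fun _ : Fin (d + 1) => Finset.Icc 1 Q,
          ∏ v, ∑' n : ℤ, φ (((∑ u, (a u : ℝ) * M u v) + n) / δ))) :=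
    tendsto_finsetSum _ fun a _ => tendsto_finsetProd _ fun v _ =>
      hasSum_periodization φ hδ _
  refine le_of_tendsto (hlim.sub_const _).norm ?_
  filter_upwards [Filter.eventually_ge_atTop {0}] with s hs
  have h0s : (0 : ℤ) ∈ s := hs (Finset.mem_singleton_self 0)
  have hexp : ∑ a ∈ Fintype.piFinset fun _ : Fin (d + 1) => Finset.Icc 1 Q,
        ∏ v, ∑ n ∈ s, ((δ : ℂ) * Φ (δ * n) * expTwoPi (n * ∑ u, (a u : ℝ) * M u v)) =
      ∑ j ∈ Fintype.piFinset fun _ : Fin m => s, (∏ v, ((δ : ℂ) * Φ (δ * j v))) *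
        ∏ u, ∑ a ∈ Finset.Icc 1 Q, expTwoPi (a * rowForm M j u) := by
    simp_rw [Finset.prod_univ_sum]
    rw [Finset.sum_comm]
    refine Finset.sum_congr rfl fun j _ => ?_
    rw [Finset.mul_sum]
    refine Finset.sum_congr rfl fun a _ => ?_
    rw [Finset.prod_mul_distrib, ← expTwoPi_sum, ← expTwoPi_sum]
    congr 2
    simp only [rowForm, Finset.mul_sum]
    rw [Finset.sum_comm]
    exact Finset.sum_congr rfl fun u _ => Finset.sum_congr rfl fun v _ => by ring
  have hmem : (0 : Fin m → ℤ) ∈ Fintype.piFinset fun _ : Fin m => s := by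
    simpa [Fintype.mem_piFinset] using fun _ => h0s
  have hzero : (∏ v, ((δ : ℂ) * Φ (δ * ((0 : Fin m → ℤ) v : ℝ)))) *
        ∏ u, ∑ a ∈ Finset.Icc 1 Q, expTwoPi (a * rowForm M 0 u) =
      (δ * ∫ x, φ x) ^ m * Q ^ (d + 1) := by
    have h1 : Φ 0 = ∫ x, φ x := by
      rw [hΦ, SchwartzMap.fourier_coe, Real.fourier_real_eq_integral_exp_smul]
      simp
    simp [rowForm, expTwoPi, h1]
  rw [hexp, ← Finset.add_sum_erase _ _ hmem, hzero, add_sub_cancel_left]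
  have hbd := hCb δ hδ hδ2 (fun x => ‖Φ x‖) (fun _ => norm_nonneg _) hBΦ
    ((Fintype.piFinset fun _ : Fin m => s).erase 0) fun j hj => (Finset.mem_erase.mp hj).1
  calc _ ≤ ∑ j ∈ (Fintype.piFinset fun _ : Fin m => s).erase 0,
        δ ^ m * ((∏ v, ‖Φ (δ * j v)‖) * ∏ u, (dNI (rowForm M j u))⁻¹) := by
        refine norm_sum_le_of_le _ fun j hj => ?_
        have hj0 := (Finset.mem_erase.mp hj).1
        rw [norm_mul, norm_prod, norm_prod, ← mul_assoc]
        have : ∏ v, ‖(δ : ℂ) * Φ (δ * j v)‖ = δ ^ m * ∏ v, ‖Φ (δ * j v)‖ := by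
          simp [Finset.prod_mul_distrib, abs_of_pos hδ]
        rw [this]
        gcongr with u
        exact norm_sum_expTwoPi_le Q (hpos j hj0 u)
    _ ≤ δ ^ m * (C * δ ^ (-ω) * Real.log (1 / δ) ^ (d + 1)) := by
        rw [← Finset.mul_sum]
        gcongr
    _ = _ := by ring

lemma exists_bump_count {d m : ℕ} {ω : ℝ} (hω : 0 < ω)
    (M : Matrix (Fin (d + 1)) (Fin m) ℝ) (hM : MAD (d + 1) m ω M) (b : ContDiffBump (0 : ℝ)) :
    ∃ C : ℝ, 0 < C ∧ ∀ Q : ℕ, ∀ δ : ℝ, 0 < δ → δ ≤ 1 / 2 →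
      |∑ a ∈ Fintype.piFinset fun _ : Fin (d + 1) => Finset.Icc 1 Q,
          ∏ v, ∑' n : ℤ, b (((∑ u, (a u : ℝ) * M u v) + n) / δ) -
        (δ * ∫ x, b x) ^ m * Q ^ (d + 1)| ≤
      C * (δ ^ m * δ ^ (-ω)) * Real.log (1 / δ) ^ (d + 1) := by
  have h1 : HasCompactSupport fun x => (b x : ℂ) :=
    b.hasCompactSupport.comp_left Complex.ofReal_zero
  have h2 : ContDiff ℝ (↑(⊤ : ℕ∞)) fun x => (b x : ℂ) :=
    Complex.ofRealCLM.contDiff.comp b.contDiff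
  obtain ⟨C, hC, h⟩ := exists_smooth_count hω M hM (h1.toSchwartzMap h2)
  refine ⟨C, hC, fun Q δ hδ hδ2 => ?_⟩
  have h3 := h Q δ hδ hδ2
  simp only [HasCompactSupport.toSchwartzMap_toFun, integral_complex_ofReal] at h3
  rw [← Real.norm_eq_abs, ← Complex.norm_real]
  push_cast
  exact h3

lemma summable_bump_periodization (b : ContDiffBump (0 : ℝ)) {δ : ℝ} (hδ : 0 < δ) (x : ℝ) :
    Summable fun n : ℤ => b ((x + n) / δ) := by
  refine summable_of_hasFiniteSupport ?_
  refine (Set.finite_Icc ⌊-(δ * b.rOut) - x⌋ ⌈δ * b.rOut - x⌉).subset fun n hn => ?_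
  have h1 : (x + n) / δ ∈ Metric.ball (0 : ℝ) b.rOut := by
    rw [← b.support_eq]; exact hn
  rw [mem_ball_zero_iff, Real.norm_eq_abs, abs_div, abs_of_pos hδ, div_lt_iff₀ hδ, abs_lt] at h1
  constructor
  · have h2 := Int.floor_le (-(δ * b.rOut) - x)
    have : (⌊-(δ * b.rOut) - x⌋ : ℝ) ≤ n := by linarith
    exact_mod_cast this
  · have h2 := Int.le_ceil (δ * b.rOut - x)
    have : (n : ℝ) ≤ ⌈δ * b.rOut - x⌉ := by linarith
    exact_mod_cast this

lemma one_le_tsum_bump (b : ContDiffBump (0 : ℝ)) (hb : 1 ≤ b.rIn) {δ : ℝ} (hδ : 0 < δ) {x : ℝ}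
    (hx : dNI x < δ) : 1 ≤ ∑' n : ℤ, b ((x + n) / δ) := by
  have h1 : b ((x + (-round x : ℤ)) / δ) = 1 := by
    refine b.one_of_mem_closedBall ?_
    rw [mem_closedBall_zero_iff, Real.norm_eq_abs, abs_div, abs_of_pos hδ]
    refine le_trans ?_ hb
    rw [div_le_one hδ]
    push_cast
    rw [← sub_eq_add_neg]
    exact hx.le
  rw [← h1]
  exact (summable_bump_periodization b hδ x).le_tsum _ fun _ _ => b.nonneg

lemma tsum_bump_eq (b : ContDiffBump (0 : ℝ)) (hb : b.rOut = 1) {δ : ℝ} (hδ : 0 < δ)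
    (hδ2 : δ ≤ 1 / 2) (x : ℝ) :
    ∑' n : ℤ, b ((x + n) / δ) = b ((x - round x) / δ) := by
  rw [tsum_eq_single (-round x)]
  · push_cast; rw [sub_eq_add_neg]
  · intro n hn
    refine b.zero_of_le_dist ?_
    rw [dist_zero_right, Real.norm_eq_abs, abs_div, abs_of_pos hδ, hb, le_div_iff₀ hδ, one_mul]
    by_contra! hlt
    refine hn ?_
    have h1 := abs_lt.mp hlt
    have h2 := abs_le.mp (abs_sub_round x)
    have h3 : -1 < n + round x := by
      have : (-1 : ℝ) < n + round x := by linarith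
      exact_mod_cast this
    have h4 : n + round x < 1 := by
      have : (n : ℝ) + round x < 1 := by linarith
      exact_mod_cast this
    omega

lemma tsum_bump_eq_zero (b : ContDiffBump (0 : ℝ)) (hb : b.rOut = 1) {δ : ℝ} (hδ : 0 < δ)
    (hδ2 : δ ≤ 1 / 2) {x : ℝ} (hx : δ ≤ dNI x) : ∑' n : ℤ, b ((x + n) / δ) = 0 := by
  rw [tsum_bump_eq b hb hδ hδ2]
  refine b.zero_of_le_dist ?_
  rw [dist_zero_right, Real.norm_eq_abs, abs_div, abs_of_pos hδ, hb, le_div_iff₀ hδ, one_mul]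
  exact hx

lemma card_eq_sum_indicator {d m : ℕ} (M : Matrix (Fin (d + 1)) (Fin m) ℝ) (Q : ℕ) (δ : ℝ) :
    (Nat.card {a : Fin (d + 1) → ℕ | (∀ u, 1 ≤ a u ∧ a u ≤ Q) ∧
      ∀ v, dNI (∑ u, (a u : ℝ) * M u v) < δ} : ℝ) =
    ∑ a ∈ Fintype.piFinset fun _ : Fin (d + 1) => Finset.Icc 1 Q,
      ∏ v, if dNI (∑ u, (a u : ℝ) * M u v) < δ then (1 : ℝ) else 0 := by
  classical
  have h : {a : Fin (d + 1) → ℕ | (∀ u, 1 ≤ a u ∧ a u ≤ Q) ∧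
      ∀ v, dNI (∑ u, (a u : ℝ) * M u v) < δ} =
      ((Fintype.piFinset fun _ : Fin (d + 1) => Finset.Icc 1 Q).filter
        fun a => ∀ v, dNI (∑ u, (a u : ℝ) * M u v) < δ : Finset (Fin (d + 1) → ℕ)) := by
    ext a
    simp [Fintype.mem_piFinset]
  rw [h, Nat.card_coe_set_eq, Set.ncard_coe_finset, Finset.card_filter]
  push_cast
  refine Finset.sum_congr rfl fun a _ => ?_
  rw [Finset.prod_ite_zero]
  simp

/-- Theorem 7 of the paper: an asymptotic formula for the number
`N(Q, δ) = #{ã ∈ ℕ^{d+1} : ‖ã·Ã‖ < δ, |ã| ≤ Q}` (here `ℕ = {1, 2, 3, …}`). -/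
theorem counting_rational_points_near_affine_subspace_averaged
    (n d : ℕ) (hd : 1 ≤ d) (hdn : d < n) (ω : ℝ) (hω : 0 < ω)
    (Atil : Matrix (Fin (d + 1)) (Fin (n - d)) ℝ)
    (hAtil : MAD (d + 1) (n - d) ω Atil) :
    ∀ ε : ℝ, 0 < ε → ∃ C : ℝ, 0 < C ∧
      ∀ Q : ℕ, 0 < Q → ∀ δ : ℝ, 0 < δ → δ ≤ 1 / 2 →
        |(Nat.card {a : Fin (d + 1) → ℕ |
            (∀ u, 1 ≤ a u ∧ a u ≤ Q) ∧
            ∀ v, dNI (∑ u, (a u : ℝ) * Atil u v) < δ} : ℝ)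
          - (2 * δ) ^ (n - d) * (Q : ℝ) ^ (d + 1)|
        ≤ ε * δ ^ (n - d) * (Q : ℝ) ^ (d + 1)
            + C * δ ^ ((n : ℝ) - d - ω) * Real.log (1 / δ) ^ (d + 1) := by
  intro ε hε
  have hη : ∃ η : ℝ, 0 < η ∧ η < 1 ∧ (1 + η) ^ (n - d) ≤ 1 + ε / 2 ^ (n - d) ∧
      1 - ε / 2 ^ (n - d) ≤ (1 - η) ^ (n - d) := by
    have hε' : 0 < ε / 2 ^ (n - d) := by positivity
    have h1 : Filter.Tendsto (fun η : ℝ => (1 + η) ^ (n - d))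
        (nhdsWithin 0 (Set.Ioi 0)) (nhds 1) := by
      have : ContinuousAt (fun η : ℝ => (1 + η) ^ (n - d)) 0 := by fun_prop
      simpa [ContinuousAt] using this.tendsto.mono_left nhdsWithin_le_nhds
    have h2 : Filter.Tendsto (fun η : ℝ => (1 - η) ^ (n - d))
        (nhdsWithin 0 (Set.Ioi 0)) (nhds 1) := by
      have : ContinuousAt (fun η : ℝ => (1 - η) ^ (n - d)) 0 := by fun_prop
      simpa [ContinuousAt] using this.tendsto.mono_left nhdsWithin_le_nhds
    obtain ⟨η, h⟩ := (((h1.eventually_le_const (show (1 : ℝ) < 1 + ε / 2 ^ (n - d) by linarith)).and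
      (h2.eventually_const_le (show 1 - ε / 2 ^ (n - d) < (1 : ℝ) by linarith))).and
      (Ioo_mem_nhdsGT (zero_lt_one (α := ℝ)))).exists
    exact ⟨η, h.2.1, h.2.2, h.1.1, h.1.2⟩
  obtain ⟨η, hη0, hη1, hη2, hη3⟩ := hη
  let bp : ContDiffBump (0 : ℝ) := ⟨1, 1 + η, one_pos, by linarith⟩
  let bm : ContDiffBump (0 : ℝ) := ⟨1 - η, 1, by linarith, by linarith⟩
  obtain ⟨C₁, hC₁, hp⟩ := exists_bump_count hω Atil hAtil bp
  obtain ⟨C₂, hC₂, hq⟩ := exists_bump_count hω Atil hAtil bm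
  refine ⟨C₁ + C₂, by positivity, fun Q _ δ hδ hδ2 => ?_⟩
  have hp := abs_le.mp (hp Q δ hδ hδ2)
  have hq := abs_le.mp (hq Q δ hδ hδ2)
  rw [card_eq_sum_indicator]
  have hup : ∑ a ∈ Fintype.piFinset fun _ : Fin (d + 1) => Finset.Icc 1 Q,
      (∏ v, if dNI (∑ u, (a u : ℝ) * Atil u v) < δ then (1 : ℝ) else 0) ≤
      ∑ a ∈ Fintype.piFinset fun _ : Fin (d + 1) => Finset.Icc 1 Q,
          ∏ v, ∑' n : ℤ, bp (((∑ u, (a u : ℝ) * Atil u v) + n) / δ) := by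
    refine Finset.sum_le_sum fun a _ => Finset.prod_le_prod (fun v _ => ?_) fun v _ => ?_
    · split_ifs <;> norm_num
    · split_ifs with h
      · exact one_le_tsum_bump bp le_rfl hδ h
      · exact tsum_nonneg fun _ => bp.nonneg
  have hlo : ∑ a ∈ Fintype.piFinset fun _ : Fin (d + 1) => Finset.Icc 1 Q,
          ∏ v, ∑' n : ℤ, bm (((∑ u, (a u : ℝ) * Atil u v) + n) / δ) ≤
      ∑ a ∈ Fintype.piFinset fun _ : Fin (d + 1) => Finset.Icc 1 Q,
      (∏ v, if dNI (∑ u, (a u : ℝ) * Atil u v) < δ then (1 : ℝ) else 0) := by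
    refine Finset.sum_le_sum fun a _ => Finset.prod_le_prod
      (fun v _ => tsum_nonneg fun _ => bm.nonneg) fun v _ => ?_
    split_ifs with h
    · rw [tsum_bump_eq bm rfl hδ hδ2]
      exact bm.le_one
    · exact (tsum_bump_eq_zero bm rfl hδ hδ2 (not_lt.mp h)).le
  have hip : ∫ x, bp x ≤ 2 * (1 + η) := by
    refine (bp.integral_le_measure_closedBall MeasureTheory.volume).trans_eq ?_
    exact Real.volume_real_closedBall (by linarith)
  have hip0 : 0 ≤ ∫ x, bp x := bp.integral_pos.le
  have him : 2 * (1 - η) ≤ ∫ x, bm x := by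
    refine Eq.trans_le ?_ (bm.measure_closedBall_le_integral MeasureTheory.volume)
    exact (Real.volume_real_closedBall (by linarith)).symm
  have hQ : (0 : ℝ) ≤ (Q : ℝ) ^ (d + 1) := by positivity
  have hδm : 0 ≤ δ ^ (n - d) := by positivity
  have hp2 : (δ * ∫ x, bp x) ^ (n - d) * (Q : ℝ) ^ (d + 1) ≤
      (2 * δ) ^ (n - d) * (Q : ℝ) ^ (d + 1) + ε * δ ^ (n - d) * (Q : ℝ) ^ (d + 1) := by
    calc _ ≤ (δ * (2 * (1 + η))) ^ (n - d) * (Q : ℝ) ^ (d + 1) := by gcongr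
      _ = (2 * δ) ^ (n - d) * (1 + η) ^ (n - d) * (Q : ℝ) ^ (d + 1) := by rw [← mul_pow]; ring_nf
      _ ≤ (2 * δ) ^ (n - d) * (1 + ε / 2 ^ (n - d)) * (Q : ℝ) ^ (d + 1) := by gcongr
      _ = _ := by rw [mul_pow]; field_simp
  have hq2 : (2 * δ) ^ (n - d) * (Q : ℝ) ^ (d + 1) - ε * δ ^ (n - d) * (Q : ℝ) ^ (d + 1) ≤
      (δ * ∫ x, bm x) ^ (n - d) * (Q : ℝ) ^ (d + 1) := by
    calc _ = (2 * δ) ^ (n - d) * (1 - ε / 2 ^ (n - d)) * (Q : ℝ) ^ (d + 1) := by rw [mul_pow]; field_simp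
      _ ≤ (2 * δ) ^ (n - d) * (1 - η) ^ (n - d) * (Q : ℝ) ^ (d + 1) := by gcongr
      _ = (δ * (2 * (1 - η))) ^ (n - d) * (Q : ℝ) ^ (d + 1) := by rw [← mul_pow]; ring_nf
      _ ≤ _ := by
        have : 0 ≤ 1 - η := by linarith
        gcongr
  have hδω : δ ^ (n - d) * δ ^ (-ω) = δ ^ ((n : ℝ) - d - ω) := by
    rw [← Real.rpow_natCast, ← Real.rpow_add hδ, Nat.cast_sub hdn.le]
    ring_nf
  rw [hδω] at hp hq
  have hL : 0 ≤ Real.log (1 / δ) := Real.log_nonneg (by rw [le_div_iff₀ hδ]; linarith)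
  have hE : 0 ≤ δ ^ ((n : ℝ) - d - ω) * Real.log (1 / δ) ^ (d + 1) := by positivity
  rw [abs_le]
  constructor
  · nlinarith [mul_nonneg hC₁.le hE]
  · nlinarith [mul_nonneg hC₂.le hE]
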